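/- arXiv:math/9801011 — 2 statements merged into one kernel-verified Lean document; each statement's English description precedes it below -/
import Mathlib

section
/- Let G_1 and G_2 be finite connected simple graphs, each with at least 2 vertices. Then the ordered Wiener polynomial of the Cartesian (box) product is multiplicative: \bar{W}(G_1 \square G_2;q) = \bar{W}(G_1;q) \cdot \bar{W}(G_2;q). -/
open Polynomial

/-- The ordered Wiener polynomial of a graph: the sum of `q^(d(u,v))` over all
ordered pairs `(u,v)` of vertices, including those with `u = v`. -/
noncomputable def orderedWienerPoly {V : Type*} [Fintype V]
    (G : SimpleGraph V) : Polynomial ℤ :=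
  ∑ u : V, ∑ v : V, X ^ G.dist u v

/-- The distance in a box product of connected graphs is the sum of the distances of the
coordinates. -/
theorem SimpleGraph.Connected.dist_boxProd {V₁ V₂ : Type*} {G₁ : SimpleGraph V₁}
    {G₂ : SimpleGraph V₂} (h₁ : G₁.Connected) (h₂ : G₂.Connected) (x y : V₁ × V₂) :
    (G₁ □ G₂).dist x y = G₁.dist x.1 y.1 + G₂.dist x.2 y.2 := by
  rw [SimpleGraph.dist, SimpleGraph.edist_boxProd]
  exact ENat.toNat_add (SimpleGraph.edist_ne_top_iff_reachable.mpr (h₁ _ _))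
    (SimpleGraph.edist_ne_top_iff_reachable.mpr (h₂ _ _))

/-- The ordered Wiener polynomial of the Cartesian (box) product of two
connected nontrivial graphs is the product of their ordered Wiener polynomials. -/
theorem orderedWienerPoly_boxProd {V₁ V₂ : Type*} [Fintype V₁] [Fintype V₂]
    (G₁ : SimpleGraph V₁) (G₂ : SimpleGraph V₂)
    (hc₁ : G₁.Connected) (hc₂ : G₂.Connected)
    (hn₁ : 2 ≤ Fintype.card V₁) (hn₂ : 2 ≤ Fintype.card V₂) :
    orderedWienerPoly (G₁ □ G₂) = orderedWienerPoly G₁ * orderedWienerPoly G₂ := by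
  simp only [orderedWienerPoly, Fintype.sum_prod_type, hc₁.dist_boxProd hc₂, pow_add,
    Finset.sum_mul_sum]
end

section
/- Let T be a finite tree (a finite connected acyclic simple graph). For each edge e of T, let n_1(e) and n_2(e) be the numbers of vertices in the two connected components of the graph T - e obtained by deleting e. Then the Wiener index of T satisfies W(T) = \sum_{e \in E(T)} n_1(e)\, n_2(e). -/
open Polynomial

/-- The Wiener polynomial of a graph: `W(G;q)` is the sum of `q^(d(u,v))` over
all unordered pairs `{u,v}` of distinct vertices. -/
noncomputable def wienerPoly {V : Type*} [Fintype V] [DecidableEq V]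
    (G : SimpleGraph V) : Polynomial ℤ :=
  ∑ e ∈ Finset.univ.filter (fun e : Sym2 V => ¬ e.IsDiag),
    X ^ (Sym2.lift ⟨fun u v => G.dist u v, fun _ _ => G.dist_comm⟩ e)

/-- The Wiener index of a graph: the sum of `d(u,v)` over all unordered pairs
`{u,v}` of distinct vertices. -/
noncomputable def wienerIndex {V : Type*} [Fintype V] [DecidableEq V]
    (G : SimpleGraph V) : ℕ :=
  ∑ e ∈ Finset.univ.filter (fun e : Sym2 V => ¬ e.IsDiag),
    Sym2.lift ⟨fun u v => G.dist u v, fun _ _ => G.dist_comm⟩ e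

/-- For an edge `e` of `G`, the product of the number of vertices of the
component of each endpoint of `e` in the graph `G` with `e` deleted. -/
noncomputable def componentCardProd {V : Type*} (G : SimpleGraph V) : Sym2 V → ℕ :=
  Sym2.lift ⟨fun u v =>
      Nat.card ((G.deleteEdges {s(u, v)}).connectedComponentMk u).supp *
        Nat.card ((G.deleteEdges {s(u, v)}).connectedComponentMk v).supp,
    fun u v => by dsimp only; rw [Sym2.eq_swap]; exact Nat.mul_comm _ _⟩

namespace SimpleGraph

variable {V : Type*} {G : SimpleGraph V}

theorem IsAcyclic.mem_edges_iff_not_reachable_deleteEdges (hG : G.IsAcyclic) {u v : V}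
    {p : G.Walk u v} (hp : p.IsPath) (e : Sym2 V) :
    e ∈ p.edges ↔ ¬ (G.deleteEdges {e}).Reachable u v := by
  classical
  refine ⟨fun he hr => ?_, fun h => ?_⟩
  · obtain ⟨q, hq⟩ := hr.exists_isPath
    have hle : G.deleteEdges {e} ≤ G := G.deleteEdges_le {e}
    have hpq : p = q.mapLe hle := congrArg Subtype.val
      ((hG.subsingleton_path u v).elim ⟨p, hp⟩ ⟨q.mapLe hle, (Walk.isPath_mapLe hle).2 hq⟩)
    rw [hpq, Walk.edges_mapLe_eq_edges] at he
    simpa using q.edges_subset_edgeSet he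
  · by_contra he
    exact h ⟨p.toDeleteEdge e he⟩

theorem IsTree.dist_eq_card_separating_edges [DecidableEq V] [Fintype G.edgeSet]
    (hG : G.IsTree) (u v : V)
    [DecidablePred fun e : Sym2 V => ¬ (G.deleteEdges {e}).Reachable u v] :
    G.dist u v =
      (G.edgeFinset.filter fun e => ¬ (G.deleteEdges {e}).Reachable u v).card := by
  obtain ⟨p, hp, hlen⟩ := hG.connected.exists_path_of_dist u v
  rw [← hlen, ← p.length_edges, ← List.toFinset_card_of_nodup hp.isTrail.edges_nodup]
  congr 1
  ext e
  rw [List.mem_toFinset, Finset.mem_filter, mem_edgeFinset,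
    ← hG.isAcyclic.mem_edges_iff_not_reachable_deleteEdges hp]
  exact ⟨fun h => ⟨p.edges_subset_edgeSet h, h⟩, And.right⟩

theorem Connected.reachable_deleteEdges_or (hG : G.Connected) (a b x : V) :
    (G.deleteEdges {s(a, b)}).Reachable x a ∨ (G.deleteEdges {s(a, b)}).Reachable x b := by
  obtain ⟨p⟩ := hG.preconnected x a
  induction p with
  | nil => exact .inl .rfl
  | @cons x y a h p ih =>
    by_cases hxy : s(x, y) = s(a, b)
    · rcases Sym2.eq_iff.1 hxy with ⟨rfl, -⟩ | ⟨rfl, -⟩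
      · exact .inl .rfl
      · exact .inr .rfl
    · have hadj : (G.deleteEdges {s(a, b)}).Adj x y := by
        simpa only [deleteEdges_adj, Set.mem_singleton_iff] using ⟨h, hxy⟩
      exact ih.imp hadj.reachable.trans hadj.reachable.trans

theorem IsTree.card_separated_pairs [Fintype V] [DecidableEq V] (hG : G.IsTree) {e : Sym2 V}
    (he : e ∈ G.edgeSet)
    [inst : DecidablePred fun f : Sym2 V =>
      ¬ (f.map (G.deleteEdges {e}).connectedComponentMk).IsDiag] :
    (Finset.univ.filter fun f : Sym2 V =>
      ¬ (f.map (G.deleteEdges {e}).connectedComponentMk).IsDiag).card =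
      componentCardProd G e := by
  classical
  revert inst
  induction e with | _ a b
  intro inst
  have hab : ¬ (G.deleteEdges {s(a, b)}).Reachable a b :=
    isBridge_iff.1 (isAcyclic_iff_forall_isBridge.1 hG.isAcyclic he)
  have hor := hG.connected.reachable_deleteEdges_or a b
  simp only [componentCardProd, Sym2.lift_mk]
  rw [Nat.card_eq_card_toFinset, Nat.card_eq_card_toFinset, ← Finset.card_product]
  symm
  refine Finset.card_bij (fun x _ => s(x.1, x.2)) ?_ ?_ ?_
  · rintro ⟨x, y⟩ hxy
    simp only [Finset.mem_product, Set.mem_toFinset, ConnectedComponent.mem_supp_iff,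
      ConnectedComponent.eq] at hxy
    simp only [Finset.mem_filter, Finset.mem_univ, true_and, Sym2.map_mk, Sym2.mk_isDiag_iff,
      ConnectedComponent.eq]
    exact fun h => hab ((hxy.1.symm.trans h).trans hxy.2)
  · rintro ⟨x, y⟩ hxy ⟨x', y'⟩ hxy' h
    simp only [Finset.mem_product, Set.mem_toFinset, ConnectedComponent.mem_supp_iff,
      ConnectedComponent.eq] at hxy hxy'
    rcases Sym2.eq_iff.1 h with ⟨rfl, rfl⟩ | ⟨rfl, rfl⟩
    · rfl
    · exact absurd (hxy.1.symm.trans hxy'.2) hab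
  · intro f hf
    induction f with | _ x y
    simp only [Finset.mem_filter, Finset.mem_univ, true_and, Sym2.map_mk, Sym2.mk_isDiag_iff,
      ConnectedComponent.eq] at hf
    simp only [Finset.mem_product, Set.mem_toFinset, ConnectedComponent.mem_supp_iff,
      ConnectedComponent.eq, exists_prop, Prod.exists]
    rcases hor x with hx | hx <;> rcases hor y with hy | hy
    · exact absurd (hx.trans hy.symm) hf
    · exact ⟨x, y, ⟨hx, hy⟩, rfl⟩
    · exact ⟨y, x, ⟨hy, hx⟩, Sym2.eq_swap⟩
    · exact absurd (hx.trans hy.symm) hf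

end SimpleGraph

/-- Wiener's theorem for trees: the Wiener index of a tree is the sum over the
edges `e` of the product `n₁(e) * n₂(e)` of the sizes of the two components of
`T - e`. -/
theorem wienerIndex_tree {V : Type*} [Fintype V] [DecidableEq V]
    (T : SimpleGraph V) [Fintype T.edgeSet] (hT : T.IsTree) :
    wienerIndex T = ∑ e ∈ T.edgeFinset, componentCardProd T e := by
  classical
  rw [← Finset.sum_congr rfl fun e he =>
    hT.card_separated_pairs (SimpleGraph.mem_edgeFinset.1 he)]
  let r : Sym2 V → Sym2 V → Prop := fun f e =>
    ¬ (f.map (T.deleteEdges {e}).connectedComponentMk).IsDiag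
  have key := Finset.sum_card_bipartiteAbove_eq_sum_card_bipartiteBelow
    (s := Finset.univ) (t := T.edgeFinset) r
  refine Eq.trans ?_ key
  rw [wienerIndex, Finset.sum_filter]
  refine Finset.sum_congr rfl fun f _ => ?_
  induction f with | _ u v
  rcases eq_or_ne u v with rfl | huv
  · simp [Finset.bipartiteAbove, r]
  · simp [huv, Finset.bipartiteAbove, r, hT.dist_eq_card_separating_edges,
      SimpleGraph.ConnectedComponent.eq]
end
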